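/- arXiv:1604.06507 — 2 statements merged into one kernel-verified Lean document; each statement's English description precedes it below -/
import Mathlib

section
/- Let M be a left A-module, f : M → M a δ-operator on M, and ε : P_• → M a projective resolution of M by left A-modules. Then there exists a δ-lifting f_• : P_• → P_• of f to P_•. -/
/-- `f` is a `δ`-operator on the left `A`-module `M`: a `k`-linear map with
`f (a • m) = δ a • m + a • f m`. -/
def IsDeltaOperator {k A M : Type*} [CommRing k] [Ring A] [Algebra k A]
    [AddCommGroup M] [Module k M] [Module A M] [IsScalarTower k A M]
    (δ : A →ₗ[k] A) (f : M →ₗ[k] M) : Prop :=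
  ∀ (a : A) (m : M), f (a • m) = δ a • m + a • f m

/-- Every projective module carries a `δ`-operator. -/
theorem exists_isDeltaOperator_of_projective {k A P : Type*} [CommRing k] [Ring A] [Algebra k A]
    [AddCommGroup P] [Module k P] [Module A P] [IsScalarTower k A P] [Module.Projective A P]
    (δ : A →ₗ[k] A) (hδ : ∀ a b : A, δ (a * b) = δ a * b + a * δ b) :
    ∃ G : P →ₗ[k] P, IsDeltaOperator δ G := by
  obtain ⟨s, hs⟩ := Module.projective_def.mp (inferInstance : Module.Projective A P)
  have map_smul_eq : ∀ (a : A) (x : P →₀ A), Finsupp.mapRange.linearMap δ (a • x) =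
      δ a • x + a • Finsupp.mapRange.linearMap δ x := by
    intro a x
    ext p
    simp [hδ]
  refine ⟨(Finsupp.linearCombination A id).restrictScalars k ∘ₗ
    Finsupp.mapRange.linearMap δ ∘ₗ s.restrictScalars k, fun a p => ?_⟩
  simp only [LinearMap.comp_apply, LinearMap.restrictScalars_apply, map_smul, map_smul_eq,
    map_add, hs p]

/-- A `δ`-operator preserving the range of an `A`-linear map out of a projective module lifts
along that map. -/
theorem IsDeltaOperator.exists_lift {k A P N : Type*} [CommRing k] [Ring A] [Algebra k A]
    [AddCommGroup P] [Module k P] [Module A P] [IsScalarTower k A P] [Module.Projective A P]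
    [AddCommGroup N] [Module k N] [Module A N] [IsScalarTower k A N]
    {δ : A →ₗ[k] A} (hδ : ∀ a b : A, δ (a * b) = δ a * b + a * δ b)
    {f : N →ₗ[k] N} (hf : IsDeltaOperator δ f) (π : P →ₗ[A] N)
    (hπ : ∀ p, f (π p) ∈ LinearMap.range π) :
    ∃ F : P →ₗ[k] P, IsDeltaOperator δ F ∧ ∀ p, π (F p) = f (π p) := by
  obtain ⟨G, hG⟩ := exists_isDeltaOperator_of_projective (P := P) δ hδ
  let defect : P →ₗ[A] LinearMap.range π :=
    { toFun := fun p => ⟨π (G p) - f (π p), sub_mem ⟨G p, rfl⟩ (hπ p)⟩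
      map_add' := fun p q => by
        ext
        simp only [map_add, Submodule.coe_add]
        abel
      map_smul' := fun a p => by
        ext
        simp only [hG a p, map_smul, hf a (π p), map_add, RingHom.id_apply,
          Submodule.coe_smul, smul_sub]
        abel }
  obtain ⟨h, hh⟩ := Module.projective_lifting_property π.rangeRestrict defect
    π.surjective_rangeRestrict
  have π_h : ∀ p, π (h p) = π (G p) - f (π p) := fun p =>
    congrArg Subtype.val (LinearMap.congr_fun hh p)
  refine ⟨G - h.restrictScalars k, fun a p => ?_, fun p => ?_⟩
  · simp only [LinearMap.sub_apply, LinearMap.restrictScalars_apply, hG a p, map_smul, smul_sub]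
    abel
  · simp [π_h]

/-- Given a projective resolution `⋯ → P 1 → P 0 → M → 0` of a left `A`-module `M`
and a `δ`-operator `f` on `M`, there exists a `δ`-lifting of `f` to the resolution:
a family of `δ`-operators `F i : P i → P i` with `ε ∘ F 0 = f ∘ ε` and
`d i ∘ F (i+1) = F i ∘ d i`. -/
theorem delta_lifting_exists
    {k A M : Type*} [CommRing k] [Ring A] [Algebra k A]
    [AddCommGroup M] [Module k M] [Module A M] [IsScalarTower k A M]
    (δ : A →ₗ[k] A) (hδ : ∀ a b : A, δ (a * b) = δ a * b + a * δ b)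
    (P : ℕ → Type*) [∀ i, AddCommGroup (P i)] [∀ i, Module k (P i)]
    [∀ i, Module A (P i)] [∀ i, IsScalarTower k A (P i)]
    [∀ i, Module.Projective A (P i)]
    (d : ∀ i, P (i + 1) →ₗ[A] P i) (ε : P 0 →ₗ[A] M)
    (hsurj : Function.Surjective ε)
    (hexact0 : LinearMap.ker ε = LinearMap.range (d 0))
    (hexact : ∀ i, LinearMap.ker (d i) = LinearMap.range (d (i + 1)))
    (f : M →ₗ[k] M) (hf : IsDeltaOperator δ f) :
    ∃ F : ∀ i, P i →ₗ[k] P i,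
      (∀ i, IsDeltaOperator δ (F i)) ∧
      (∀ p : P 0, ε (F 0 p) = f (ε p)) ∧
      (∀ i (p : P (i + 1)), d i (F (i + 1) p) = F i (d i p)) := by
  obtain ⟨F₀, hF₀, ε_F₀⟩ := hf.exists_lift hδ ε fun p => hsurj _
  let RangePreserving (i : ℕ) :=
    {F : P i →ₗ[k] P i // IsDeltaOperator δ F ∧ ∀ p, F (d i p) ∈ LinearMap.range (d i)}
  have exists_next : ∀ i (F : RangePreserving i), ∃ F' : RangePreserving (i + 1),
      ∀ p, d i (F'.1 p) = F.1 (d i p) := by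
    rintro i ⟨F, hF, hrange⟩
    obtain ⟨F', hF', comm⟩ := hF.exists_lift hδ (d i) hrange
    refine ⟨⟨F', hF', fun p => ?_⟩, comm⟩
    have hp : d i (d (i + 1) p) = 0 := by
      rw [← LinearMap.mem_ker, hexact]
      exact ⟨p, rfl⟩
    rw [← hexact, LinearMap.mem_ker, comm, hp, map_zero]
  choose next hnext using exists_next
  have F₀_range : ∀ p, F₀ (d 0 p) ∈ LinearMap.range (d 0) := fun p => by
    have hp : ε (d 0 p) = 0 := by
      rw [← LinearMap.mem_ker, hexact0]
      exact ⟨p, rfl⟩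
    rw [← hexact0, LinearMap.mem_ker, ε_F₀, hp, map_zero]
  let F : ∀ i, RangePreserving i := fun i => Nat.rec ⟨F₀, hF₀, F₀_range⟩ next i
  exact ⟨fun i => (F i).1, fun i => (F i).2.1, ε_F₀, fun i => hnext i (F i)⟩
end

section
/- Let M be a left A-module, f : M → M a δ-operator, let ε : P_• → M and ε' : P'_• → M be projective resolutions of M by left A-modules, let f_• and f'_• be δ-liftings of f to P_• and to P'_• respectively, and let α_• : P'_• → P_• be a chain map of complexes of A-modules lifting the identity of M. Then the two morphisms of cochain complexes α_•^* ∘ f_•^♯ and f'_•^♯ ∘ α_•^* from Hom_A(P_•, M) to Hom_A(P'_•, M) are chain homotopic, where f_i^♯(φ) = f ∘ φ − φ ∘ f_i, f'_i^♯(ψ) = f ∘ ψ − ψ ∘ f'_i, and α_i^*(φ) = φ ∘ α_i. -/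
/-- A linear map out of a projective module whose image lies in the range of `d` factors
through `d`. -/
theorem Module.Projective.exists_comp_eq_of_range_le {A X Y Z : Type*} [Ring A]
    [AddCommGroup X] [Module A X] [AddCommGroup Y] [Module A Y] [AddCommGroup Z] [Module A Z]
    [Module.Projective A X] (d : Y →ₗ[A] Z) (h : X →ₗ[A] Z)
    (hr : ∀ x, h x ∈ LinearMap.range d) : ∃ s : X →ₗ[A] Y, ∀ x, d (s x) = h x := by
  obtain ⟨s, hs⟩ := Module.projective_lifting_property d.rangeRestrict
    (h.codRestrict (LinearMap.range d) hr) d.surjective_rangeRestrict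
  exact ⟨s, fun x => congrArg Subtype.val (LinearMap.congr_fun hs x)⟩

/-- A chain map from a complex of projectives to a resolution which lifts the zero map is
null-homotopic. -/
theorem exists_nullHomotopy_of_lifts_zero {A M : Type*} [Ring A] [AddCommGroup M] [Module A M]
    (P : ℕ → Type*) [∀ i, AddCommGroup (P i)] [∀ i, Module A (P i)]
    (d : ∀ i, P (i + 1) →ₗ[A] P i) (ε : P 0 →ₗ[A] M)
    (hexact0 : LinearMap.ker ε = LinearMap.range (d 0))
    (hexact : ∀ i, LinearMap.ker (d i) = LinearMap.range (d (i + 1)))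
    (P' : ℕ → Type*) [∀ i, AddCommGroup (P' i)] [∀ i, Module A (P' i)]
    [∀ i, Module.Projective A (P' i)]
    (d' : ∀ i, P' (i + 1) →ₗ[A] P' i) (hd' : ∀ i p, d' i (d' (i + 1) p) = 0)
    (g : ∀ i, P' i →ₗ[A] P i) (hg0 : ∀ p, ε (g 0 p) = 0)
    (hgd : ∀ i p, d i (g (i + 1) p) = g i (d' i p)) :
    ∃ s : ∀ i, P' i →ₗ[A] P (i + 1),
      (∀ p, g 0 p = d 0 (s 0 p)) ∧
      ∀ i p, g (i + 1) p = d (i + 1) (s (i + 1) p) + s i (d' i p) := by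
  obtain ⟨s₀, hs₀⟩ := Module.Projective.exists_comp_eq_of_range_le (d 0) (g 0)
    fun p => hexact0 ▸ LinearMap.mem_ker.2 (hg0 p)
  have step (i : ℕ) (s : {s : P' i →ₗ[A] P (i + 1) // ∀ p, d i (s (d' i p)) = g i (d' i p)}) :
      ∃ t : {t : P' (i + 1) →ₗ[A] P (i + 2) //
          ∀ p, d (i + 1) (t (d' (i + 1) p)) = g (i + 1) (d' (i + 1) p)},
        ∀ p, g (i + 1) p = d (i + 1) (t.1 p) + s.1 (d' i p) := by
    obtain ⟨t, ht⟩ := Module.Projective.exists_comp_eq_of_range_le (d (i + 1))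
      (g (i + 1) - s.1 ∘ₗ d' i) fun p => by
        rw [← hexact i, LinearMap.mem_ker]
        simp [hgd, s.2]
    exact ⟨⟨t, fun p => by simp [ht, hd']⟩, fun p => by simp [ht]⟩
  choose next hnext using step
  let s (i : ℕ) : {s : P' i →ₗ[A] P (i + 1) // ∀ p, d i (s (d' i p)) = g i (d' i p)} :=
    Nat.rec ⟨s₀, fun p => hs₀ _⟩ next i
  exact ⟨fun i => (s i).1, fun p => (hs₀ p).symm, fun i => hnext i (s i)⟩

/-- Given `δ`-liftings `F`, `F'` of a `δ`-operator `f` to projective resolutions `P_•`,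
`P'_•` of `M`, and a chain map `α : P'_• → P_•` of `A`-modules lifting `id_M`, the two
cochain maps `α^* ∘ F♯` and `F'♯ ∘ α^*` from `Hom_A(P_•, M)` to `Hom_A(P'_•, M)` are
chain homotopic: there are `k`-linear maps
`σ i : Hom_A(P (i+1), M) → Hom_A(P' i, M)` satisfying the homotopy identities. -/
theorem sharp_commutes_with_comparison_up_to_homotopy
    {k A M : Type*} [CommRing k] [Ring A] [Algebra k A]
    [AddCommGroup M] [Module k M] [Module A M] [IsScalarTower k A M]
    (δ : A →ₗ[k] A) (hδ : ∀ a b : A, δ (a * b) = δ a * b + a * δ b)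
    (P : ℕ → Type*) [∀ i, AddCommGroup (P i)] [∀ i, Module k (P i)]
    [∀ i, Module A (P i)] [∀ i, IsScalarTower k A (P i)]
    [∀ i, Module.Projective A (P i)]
    (d : ∀ i, P (i + 1) →ₗ[A] P i) (ε : P 0 →ₗ[A] M)
    (hsurj : Function.Surjective ε)
    (hexact0 : LinearMap.ker ε = LinearMap.range (d 0))
    (hexact : ∀ i, LinearMap.ker (d i) = LinearMap.range (d (i + 1)))
    (P' : ℕ → Type*) [∀ i, AddCommGroup (P' i)] [∀ i, Module k (P' i)]
    [∀ i, Module A (P' i)] [∀ i, IsScalarTower k A (P' i)]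
    [∀ i, Module.Projective A (P' i)]
    (d' : ∀ i, P' (i + 1) →ₗ[A] P' i) (ε' : P' 0 →ₗ[A] M)
    (hsurj' : Function.Surjective ε')
    (hexact0' : LinearMap.ker ε' = LinearMap.range (d' 0))
    (hexact' : ∀ i, LinearMap.ker (d' i) = LinearMap.range (d' (i + 1)))
    (f : M →ₗ[k] M) (hf : IsDeltaOperator δ f)
    (F : ∀ i, P i →ₗ[k] P i)
    (hF0 : ∀ i, IsDeltaOperator δ (F i))
    (hFε : ∀ p : P 0, ε (F 0 p) = f (ε p))
    (hFd : ∀ i (p : P (i + 1)), d i (F (i + 1) p) = F i (d i p))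
    (F' : ∀ i, P' i →ₗ[k] P' i)
    (hF'0 : ∀ i, IsDeltaOperator δ (F' i))
    (hF'ε : ∀ p : P' 0, ε' (F' 0 p) = f (ε' p))
    (hF'd : ∀ i (p : P' (i + 1)), d' i (F' (i + 1) p) = F' i (d' i p))
    (α : ∀ i, P' i →ₗ[A] P i)
    (hα0 : ∀ p : P' 0, ε (α 0 p) = ε' p)
    (hαd : ∀ i (p : P' (i + 1)), d i (α (i + 1) p) = α i (d' i p)) :
    ∃ σ : ∀ i, (P (i + 1) →ₗ[A] M) →ₗ[k] (P' i →ₗ[A] M),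
      (∀ (φ : P 0 →ₗ[A] M) (p : P' 0),
        (f (φ (α 0 p)) - φ (F 0 (α 0 p))) - (f (φ (α 0 p)) - φ (α 0 (F' 0 p)))
          = σ 0 (φ ∘ₗ d 0) p) ∧
      (∀ i (φ : P (i + 1) →ₗ[A] M) (p : P' (i + 1)),
        (f (φ (α (i + 1) p)) - φ (F (i + 1) (α (i + 1) p)))
            - (f (φ (α (i + 1) p)) - φ (α (i + 1) (F' (i + 1) p)))
          = σ (i + 1) (φ ∘ₗ d (i + 1)) p + σ i φ (d' i p)) := by
  have hd' (i : ℕ) (p : P' (i + 2)) : d' i (d' (i + 1) p) = 0 := by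
    rw [← LinearMap.mem_ker, hexact' i]
    exact ⟨p, rfl⟩
  let g (i : ℕ) : P' i →ₗ[A] P i :=
    { toFun := fun p => α i (F' i p) - F i (α i p)
      map_add' := fun p q => by simp only [map_add]; abel
      map_smul' := fun a p => by
        simp only [map_smul, map_add, hF'0 i a p, hF0 i a (α i p), RingHom.id_apply, smul_sub]
        abel }
  have hg (i : ℕ) (p : P' i) : g i p = α i (F' i p) - F i (α i p) := rfl
  obtain ⟨s, hs0, hs⟩ := exists_nullHomotopy_of_lifts_zero P d ε hexact0 hexact P' d' hd' g
    (fun p => by simp [hg, hα0, hFε, hF'ε]) (fun i p => by simp [hg, hαd, hFd, hF'd])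
  refine ⟨fun i =>
    { toFun := fun φ => φ ∘ₗ s i
      map_add' := fun φ ψ => LinearMap.add_comp _ _ _
      map_smul' := fun c φ => LinearMap.smul_comp _ _ _ }, fun φ p => ?_, fun i φ p => ?_⟩
  · simp [← hs0, hg]
  · have h := congrArg φ (hs i p)
    rw [hg, map_sub, map_add] at h
    simpa using h
end
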